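/- Let k ∈ ℤ∖{0}, m,n ∈ ℤ, and let f : ℝ² → ℂ satisfy Σ_{a,b∈ℤ} |f(x+a,t+b)| < ∞ for every (x,t) ∈ ℝ². Define the periodization Θ : ℝ⁵ → ℂ by Θ(g̃) = Σ_{a,b∈ℤ} (π_k^{m,n}((a,0,0,b,0) ⋆ g̃)f)(0,0). Then: (i) Θ(x,y,z,t,u) = e^{−4πiku}·(ϑ_k^{m,n}f)(x,y,z,t) for all (x,y,z,t,u); (ii) Θ is invariant under left translation by the integral lattice: Θ(γ ⋆ g̃) = Θ(g̃) for every γ = (p,q,r,s,w) with p,q,r,s ∈ ℤ and w ∈ (1/2)ℤ and every g̃ ∈ ℝ⁵; (iii) Θ is equivariant under the center: Θ(g̃ ⋆ (0,0,0,0,s)) = e^{−4πiks}·Θ(g̃) for all s ∈ ℝ and g̃ ∈ ℝ⁵. -/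

import Mathlib

noncomputable section

/-- The underlying set `ℝ⁵` of the group `G̃`. -/
abbrev G5 : Type := ℝ × ℝ × ℝ × ℝ × ℝ

/-- Multiplication on `G̃`. -/
def gtmul (g₁ g₂ : G5) : G5 :=
  (g₁.1 + g₂.1, g₁.2.1 + g₂.2.1, g₁.2.2.1 + g₂.2.2.1 - g₁.2.1 * g₂.1,
   g₁.2.2.2.1 + g₂.2.2.2.1,
   g₁.2.2.2.2 + g₂.2.2.2.2 + g₁.2.2.1 * g₂.1 - (1 / 2) * g₁.2.1 * g₂.1 ^ 2
     + g₁.2.2.2.1 * g₂.2.1)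

/-- The representation `π_k^{m,n}` of `G̃` on functions on `ℝ²`. -/
def pirep (k m n : ℤ) (g : G5) (f : ℝ × ℝ → ℂ) : ℝ × ℝ → ℂ := fun p =>
  Complex.exp (Complex.I *
      ((-4) * Real.pi * (k : ℝ) *
        (g.2.2.2.2 + g.2.1 * p.2 - g.2.2.1 * (p.1 + g.1) - g.1 * g.2.1 * p.1 -
          (g.2.1 / 2) * (p.1 ^ 2 + g.1 ^ 2)) : ℝ)) *
    Complex.exp (Complex.I *
      ((-2) * Real.pi *
        ((m : ℝ) * g.2.1 - (n : ℝ) * (g.2.2.1 + g.2.1 * (p.1 + g.1))) : ℝ)) *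
    f (p.1 + g.1, p.2 + g.2.2.2.1)

/-- The function `ϑ_k^{m,n}f : ℝ⁴ → ℂ`. -/
def thetaF (k m n : ℤ) (f : ℝ × ℝ → ℂ) (x y z t : ℝ) : ℂ :=
  Complex.exp (Complex.I *
      ((-2) * Real.pi * ((m : ℝ) * y - (n : ℝ) * (z + x * y)) : ℝ)) *
    Complex.exp (Complex.I * (4 * Real.pi * (k : ℝ) * (z * x) : ℝ)) *
    ∑' ab : ℤ × ℤ,
      Complex.exp (Complex.I *
          (2 * Real.pi * (n : ℝ) * y * (ab.1 : ℝ) : ℝ)) *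
        Complex.exp (Complex.I *
          ((-4) * Real.pi * (k : ℝ) *
            ((ab.2 : ℝ) * y - z * (ab.1 : ℝ) - (y / 2) * (x + (ab.1 : ℝ)) ^ 2) : ℝ)) *
        f (x + (ab.1 : ℝ), t + (ab.2 : ℝ))

/-- The periodization `Θ(g̃) = Σ_{a,b∈ℤ} (π_k^{m,n}((a,0,0,b,0) ⋆ g̃)f)(0,0)`. -/
def ThetaP (k m n : ℤ) (f : ℝ × ℝ → ℂ) (g : G5) : ℂ :=
  ∑' ab : ℤ × ℤ,
    pirep k m n (gtmul ((ab.1 : ℝ), (0 : ℝ), (0 : ℝ), (ab.2 : ℝ), (0 : ℝ)) g) f (0, 0)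

/-- The general term of the periodization, written out. -/
theorem term_eq (k m n : ℤ) (f : ℝ × ℝ → ℂ) (a b x y z t u : ℝ) :
    pirep k m n (gtmul (a, (0 : ℝ), (0 : ℝ), b, (0 : ℝ)) (x, y, z, t, u)) f (0, 0) =
      Complex.exp (Complex.I *
        ((-4) * Real.pi * (k : ℝ) * (u + b * y - z * (x + a) - (y / 2) * (x + a) ^ 2)
          + (-2) * Real.pi * ((m : ℝ) * y - (n : ℝ) * (z + y * (x + a))) : ℝ)) *
        f (x + a, t + b) := by
  simp only [pirep, gtmul]
  rw [← Complex.exp_add]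
  congr 1
  · congr 1
    push_cast
    ring
  · congr 1
    ext <;> ring

/-- The phase is unchanged by a shift by an integral multiple of `2π`. -/
theorem exp_shift (A B : ℝ) (N : ℤ) (h : A = B + 2 * Real.pi * (N : ℝ)) :
    Complex.exp (Complex.I * (A : ℝ)) = Complex.exp (Complex.I * (B : ℝ)) := by
  rw [Complex.exp_eq_exp_iff_exists_int]
  refine ⟨N, ?_⟩
  rw [h]
  push_cast
  ring

/-- (i) `Θ(x,y,z,t,u) = e^{−4πiku}·(ϑ_k^{m,n}f)(x,y,z,t)`; (ii) `Θ` is invariant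
under left translation by the integral lattice `Γ̃`; (iii) `Θ` is equivariant
under the center. -/
theorem stmt16 (k m n : ℤ) (hk : k ≠ 0) (f : ℝ × ℝ → ℂ)
    (hf : ∀ x t : ℝ,
      Summable fun ab : ℤ × ℤ => ‖f (x + (ab.1 : ℝ), t + (ab.2 : ℝ))‖) :
    (∀ x y z t u : ℝ,
      ThetaP k m n f (x, y, z, t, u) =
        Complex.exp (Complex.I * ((-4) * Real.pi * (k : ℝ) * u : ℝ)) *
          thetaF k m n f x y z t) ∧
    (∀ p q r s j : ℤ, ∀ g : G5,
      ThetaP k m n f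
          (gtmul ((p : ℝ), (q : ℝ), (r : ℝ), (s : ℝ), (j : ℝ) / 2) g) =
        ThetaP k m n f g) ∧
    (∀ s : ℝ, ∀ g : G5,
      ThetaP k m n f (gtmul g ((0 : ℝ), (0 : ℝ), (0 : ℝ), (0 : ℝ), s)) =
        Complex.exp (Complex.I * ((-4) * Real.pi * (k : ℝ) * s : ℝ)) *
          ThetaP k m n f g) := by
  refine ⟨?_, ?_, ?_⟩
  · intro x y z t u
    unfold ThetaP thetaF
    rw [← mul_assoc, ← tsum_mul_left]
    refine tsum_congr fun ab => ?_
    rw [term_eq]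
    simp only [← mul_assoc]
    congr 1
    simp only [← Complex.exp_add]
    congr 1
    push_cast
    ring
  · rintro p q r s j ⟨x, y, z, t, u⟩
    unfold ThetaP
    rw [← (Equiv.addRight ((p, s) : ℤ × ℤ)).tsum_eq (fun ab : ℤ × ℤ =>
      pirep k m n (gtmul ((ab.1 : ℝ), (0 : ℝ), (0 : ℝ), (ab.2 : ℝ), (0 : ℝ))
        (x, y, z, t, u)) f (0, 0))]
    refine tsum_congr fun ab => ?_
    obtain ⟨a, b⟩ := ab
    simp only [Equiv.coe_addRight, Prod.mk_add_mk]
    rw [term_eq, term_eq]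
    simp only [gtmul]
    congr 1
    · apply exp_shift _ _ (-k * (j + 2 * b * q - 2 * r * (a + p) - q * (a + p) ^ 2)
        - (m * q - n * (r + q * (a + p))))
      push_cast
      ring
    · congr 1
      ext <;> push_cast <;> ring
  · rintro s ⟨x, y, z, t, u⟩
    unfold ThetaP
    rw [← tsum_mul_left]
    refine tsum_congr fun ab => ?_
    simp only [gtmul.eq_1 (x, y, z, t, u)]
    rw [term_eq, term_eq, ← mul_assoc, ← Complex.exp_add]
    congr 1
    · congr 1
      push_cast
      ring
    · congr 1
      ext <;> ring

end
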